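/- Let K be an algebraically closed field of uncountable cardinality whose transcendence degree over its prime subfield equals #K, and let τ be an unbounded automorphism of K fixing pointwise the relative algebraic closure of the prime field. Let X be a relatively algebraically closed subfield of K containing the relative algebraic closure of the prime field, of transcendence degree strictly less than #K, with τ(X) = X. Let f and g be field automorphisms of X, let Y be an acceptable extension of X, and let h be a field automorphism of Y extending Ψ_X(f,g) = f ∘ (τ|_X) ∘ g ∘ (τ|_X)⁻¹ ∘ g⁻¹ ∘ f⁻¹. Then there exist automorphisms f' and g' of K extending f and g respectively such that the automorphism Ψ(f',g') = f' ∘ τ ∘ g' ∘ τ⁻¹ ∘ g'⁻¹ ∘ f'⁻¹ of K extends h. -/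

import Mathlib

open Cardinal

/-- `cl A`: the set of elements of `K` algebraic over the subfield generated by `A`
(over the prime field). -/
def cl (K : Type*) [Field K] (A : Set K) : Set K :=
  {x : K | IsAlgebraic (Subfield.closure A) x}

/-- An automorphism `τ` of `K` is bounded if there is a subset `A` of `K` of
cardinality `< #K` such that `τ b ∈ cl (A ∪ {b})` for every `b ∉ cl A`. -/
def IsBounded {K : Type*} [Field K] (τ : K ≃+* K) : Prop :=
  ∃ A : Set K, #A < #K ∧ ∀ b : K, b ∉ cl K A → τ b ∈ cl K (A ∪ {b})

/-- The transcendence degree of `K` over its prime subfield equals `#K`. -/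
def FullTrdeg (K : Type*) [Field K] : Prop :=
  ∃ s : Set K, IsTranscendenceBasis (⊥ : Subfield K) ((↑) : s → K) ∧ #s = #K

/-- A subfield `X` of `K` is relatively algebraically closed in `K`. -/
def RelAlgClosed {K : Type*} [Field K] (X : Subfield K) : Prop :=
  ∀ x : K, IsAlgebraic X x → x ∈ X

/-- `X` contains the relative algebraic closure of the prime field in `K`. -/
def ContainsBotAlg {K : Type*} [Field K] (X : Subfield K) : Prop :=
  ∀ x : K, IsAlgebraic (⊥ : Subfield K) x → x ∈ X

/-- The subfield `X` has transcendence degree `< #K` over the prime field. -/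
def SmallTrdeg {K : Type*} [Field K] (X : Subfield K) : Prop :=
  ∃ s : Set X, IsTranscendenceBasis (⊥ : Subfield ↥X) ((↑) : s → ↥X) ∧ #s < #K

/-- `X ⊆ Y` is an acceptable extension: `Y = cl (X ∪ A)` for some countably infinite
set `A` algebraically independent over `X`. -/
def Acceptable {K : Type*} [Field K] (X Y : Subfield K) : Prop :=
  X ≤ Y ∧ ∃ A : Set K, A.Countable ∧ A.Infinite ∧
    AlgebraicIndependent ↥X ((↑) : A → K) ∧ (Y : Set K) = cl K ((X : Set K) ∪ A)

/-- The restriction of `τ` to a `τ`-invariant subfield `X`, as an automorphism of `X`. -/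
def restrict {K : Type*} [Field K] (τ : K ≃+* K) (X : Subfield K)
    (hX : X.map (τ : K →+* K) = X) : ↥X ≃+* ↥X where
  toFun x := ⟨τ x, by
    have h : τ (x : K) ∈ X.map (τ : K →+* K) := Subfield.mem_map.mpr ⟨x, x.2, rfl⟩
    rwa [hX] at h⟩
  invFun y := ⟨τ.symm y, by
    have hy : (y : K) ∈ X.map (τ : K →+* K) := by rw [hX]; exact y.2
    obtain ⟨z, hz, hzy⟩ := Subfield.mem_map.mp hy
    have hzz : τ.symm y = z := by rw [← hzy]; exact τ.symm_apply_apply z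
    rw [hzz]; exact hz⟩
  left_inv x := Subtype.ext (τ.symm_apply_apply x)
  right_inv y := Subtype.ext (τ.apply_symm_apply y)
  map_mul' x y := Subtype.ext (by
    show τ ((x : K) * (y : K)) = τ (x : K) * τ (y : K)
    exact map_mul τ (x : K) (y : K))
  map_add' x y := Subtype.ext (by
    show τ ((x : K) + (y : K)) = τ (x : K) + τ (y : K)
    exact map_add τ (x : K) (y : K))

/-- `psi t f g = Ψ(f,g) = f ∘ t ∘ g ∘ t⁻¹ ∘ g⁻¹ ∘ f⁻¹` (`RingEquiv.trans a b` applies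
`a` first), so `psi t f g x = f (t (g (t⁻¹ (g⁻¹ (f⁻¹ x)))))`. -/
def psi {R : Type*} [Field R] (t f g : R ≃+* R) : R ≃+* R :=
  ((((f.symm.trans g.symm).trans t.symm).trans g).trans t).trans f

open TensorProduct

theorem exists_algHom_ne_zero {k A : Type*} [Field k] [IsAlgClosed k] [CommRing A] [IsDomain A]
    [Algebra k A] [Algebra.FiniteType k A] {a : A} (ha : a ≠ 0) :
    ∃ φ : A →ₐ[k] k, φ a ≠ 0 := by
  let B := Localization.Away a
  have : Algebra.FiniteType A B := IsLocalization.finiteType_of_monoid_fg (Submonoid.powers a) B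
  have : Algebra.FiniteType k B := Algebra.FiniteType.trans (S := A) inferInstance inferInstance
  have : Nontrivial B :=
    (IsLocalization.injective B (powers_le_nonZeroDivisors_of_noZeroDivisors ha)).nontrivial
  obtain ⟨M, hM⟩ := Ideal.exists_maximal B
  let F := B ⧸ M
  let _ : Field F := Ideal.Quotient.field M
  have : Algebra.FiniteType k F :=
    Algebra.FiniteType.of_surjective (Ideal.Quotient.mkₐ k M) (Ideal.Quotient.mkₐ_surjective k M)
  have : Module.Finite k F := finite_of_finite_type_of_isJacobsonRing k F
  let e : k ≃ₐ[k] F :=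
    AlgEquiv.ofBijective (Algebra.ofId k F) IsAlgClosed.algebraMap_bijective_of_isIntegral
  let φ : A →ₐ[k] k := (e.symm : F →ₐ[k] k).comp
    ((Ideal.Quotient.mkₐ k M).comp (IsScalarTower.toAlgHom k A B))
  have hu : IsUnit (algebraMap A B a) := IsLocalization.Away.algebraMap_isUnit a
  exact ⟨φ, ((hu.map (Ideal.Quotient.mkₐ k M)).map (e.symm : F →ₐ[k] k)).ne_zero⟩

theorem TensorProduct.exists_finite_forall_mem_range_map {k A B : Type*} [Field k] [CommRing A]
    [CommRing B] [Algebra k A] [Algebra k B] (u : A ⊗[k] B) :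
    ∃ s : Set A, s.Finite ∧ ∀ A₀ : Subalgebra k A, s ⊆ A₀ →
      u ∈ (Algebra.TensorProduct.map A₀.val (AlgHom.id k B)).range := by
  induction u with
  | zero => exact ⟨∅, Set.finite_empty, fun _ _ ↦ zero_mem _⟩
  | tmul a b =>
    exact ⟨{a}, Set.finite_singleton a, fun A₀ h ↦
      ⟨(⟨a, h rfl⟩ : A₀) ⊗ₜ b, by simp⟩⟩
  | add u v hu hv =>
    obtain ⟨s, hs, hs'⟩ := hu
    obtain ⟨t, ht, ht'⟩ := hv
    exact ⟨s ∪ t, hs.union ht, fun A₀ h ↦ add_mem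
      (hs' A₀ (Set.subset_union_left.trans h)) (ht' A₀ (Set.subset_union_right.trans h))⟩

theorem noZeroDivisors_tensorProduct_of_finiteType (k A B : Type*) [Field k] [IsAlgClosed k]
    [CommRing A] [IsDomain A] [CommRing B] [IsDomain B] [Algebra k A] [Algebra k B]
    [Algebra.FiniteType k A] : NoZeroDivisors (A ⊗[k] B) := by
  let b := Module.Basis.ofVectorSpace k B
  let b' := Algebra.TensorProduct.basis A b
  let Φ (φ : A →ₐ[k] k) : A ⊗[k] B →ₐ[k] B :=
    Algebra.TensorProduct.lift ((Algebra.ofId k B).comp φ) (AlgHom.id k B) fun _ _ ↦ .all _ _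
  have hΦ (φ : A →ₐ[k] k) (u : A ⊗[k] B) (i) : b.repr (Φ φ u) i = φ (b'.repr u i) := by
    induction u with
    | zero => simp
    | tmul x y => simp [Φ, b', Algebra.TensorProduct.basis_repr_tmul, Algebra.ofId_apply,
        ← Algebra.smul_def]
    | add u v hu hv => simp [hu, hv]
  have hne {u : A ⊗[k] B} (hu : u ≠ 0) : ∃ i, b'.repr u i ≠ 0 := by
    by_contra! h
    exact hu (b'.repr.map_eq_zero_iff.1 (Finsupp.ext h))
  refine ⟨fun {u v} huv ↦ ?_⟩
  by_contra! h
  obtain ⟨i, hi⟩ := hne h.1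
  obtain ⟨j, hj⟩ := hne h.2
  obtain ⟨φ, hφ⟩ := exists_algHom_ne_zero (k := k) (mul_ne_zero hi hj)
  rw [map_mul, ← hΦ, ← hΦ] at hφ
  have h0 : Φ φ u * Φ φ v = 0 := by rw [← map_mul, huv, map_zero]
  rcases mul_eq_zero.1 h0 with h0 | h0 <;> simp [h0] at hφ

/-- Over an algebraically closed field, the tensor product of two domains is a domain. -/
theorem isDomain_tensorProduct (k A B : Type*) [Field k] [IsAlgClosed k]
    [CommRing A] [IsDomain A] [CommRing B] [IsDomain B] [Algebra k A] [Algebra k B] :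
    IsDomain (A ⊗[k] B) := by
  have : NoZeroDivisors (A ⊗[k] B) := by
    refine ⟨fun {u v} huv ↦ ?_⟩
    obtain ⟨s, hs, hs'⟩ := TensorProduct.exists_finite_forall_mem_range_map u
    obtain ⟨t, ht, ht'⟩ := TensorProduct.exists_finite_forall_mem_range_map v
    let A₀ := Algebra.adjoin k (s ∪ t)
    have : Algebra.FiniteType k A₀ :=
      A₀.fg_iff_finiteType.1 (Subalgebra.fg_def.2 ⟨_, hs.union ht, rfl⟩)
    have := noZeroDivisors_tensorProduct_of_finiteType k A₀ B
    obtain ⟨u, rfl⟩ := hs' A₀ (Set.subset_union_left.trans Algebra.subset_adjoin)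
    obtain ⟨v, rfl⟩ := ht' A₀ (Set.subset_union_right.trans Algebra.subset_adjoin)
    have hinj : Function.Injective (Algebra.TensorProduct.map A₀.val (AlgHom.id k B)) :=
      Module.Flat.rTensor_preserves_injective_linearMap A₀.val.toLinearMap Subtype.val_injective
    have h0 : u * v = 0 := hinj (by simpa using huv)
    rcases mul_eq_zero.1 h0 with rfl | rfl <;> simp
  exact NoZeroDivisors.to_isDomain _

/-- Two maps from isomorphic rings into algebraically closed fields, with transcendence bases
indexed by the same type, are intertwined by an isomorphism of the fields matching the bases. -/
theorem exists_ringEquiv_of_isTranscendenceBasis {R S K L ι : Type*} [CommRing R] [CommRing S]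
    [Field K] [Field L] [IsAlgClosed K] [IsAlgClosed L] [Algebra R K] [Algebra S L]
    (θ : R ≃+* S) {v : ι → K} {w : ι → L}
    (hv : IsTranscendenceBasis R v) (hw : IsTranscendenceBasis S w) :
    ∃ G : K ≃+* L, (∀ r, G (algebraMap R K r) = algebraMap S L (θ r)) ∧ ∀ i, G (v i) = w i := by
  have := IsAlgClosed.isAlgClosure_of_transcendence_basis v hv
  have := IsAlgClosed.isAlgClosure_of_transcendence_basis w hw
  let e : Algebra.adjoin R (Set.range v) ≃+* Algebra.adjoin S (Set.range w) :=
    (hv.1.aevalEquiv.symm.toRingEquiv.trans (MvPolynomial.mapEquiv ι θ)).trans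
      hw.1.aevalEquiv.toRingEquiv
  have he (p) : e (hv.1.aevalEquiv p) = hw.1.aevalEquiv (MvPolynomial.map θ p) := by
    simp [e]
  have hG (p) := IsAlgClosure.equivOfEquiv_algebraMap K L e (hv.1.aevalEquiv p)
  simp only [he, AlgebraicIndependent.algebraMap_aevalEquiv] at hG
  exact ⟨IsAlgClosure.equivOfEquiv K L e, fun r ↦ by simpa using hG (MvPolynomial.C r),
    fun i ↦ by simpa using hG (MvPolynomial.X i)⟩

theorem isAlgebraic_map_of_isAlgebraic_adjoin {k A T ι σ : Type*} [Field k] [CommRing A]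
    [CommRing T] [Algebra k A] [Algebra k T] [Algebra (MvPolynomial σ k) T] {v : ι → A}
    (hv : AlgebraicIndependent k v) {x : A}
    (hx : IsAlgebraic (Algebra.adjoin k (Set.range v)) x) (g : A →ₐ[k] T) (i : ι → σ)
    (hi : Function.Injective i)
    (h : ∀ p : MvPolynomial ι k,
      algebraMap (MvPolynomial σ k) T (MvPolynomial.rename i p) = g (MvPolynomial.aeval v p)) :
    IsAlgebraic (MvPolynomial σ k) (g x) := by
  refine hx.ringHom_of_comp_eq ((MvPolynomial.rename i).comp hv.aevalEquiv.symm.toAlgHom) g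
    ((MvPolynomial.rename_injective i hi).comp hv.aevalEquiv.symm.injective) ?_
  ext a
  obtain ⟨p, rfl⟩ := hv.aevalEquiv.surjective a
  simp [h]

/-- Over an algebraically closed field `k`, extensions of `k` inside a field that are free from each
other are linearly disjoint. -/
theorem productMap_injective_of_algebraicIndependent {k K A B ι κ : Type*} [Field k]
    [IsAlgClosed k] [Field K] [CommRing A] [IsDomain A] [CommRing B] [IsDomain B]
    [Algebra k K] [Algebra k A] [Algebra k B] (f : A →ₐ[k] K) (g : B →ₐ[k] K)
    (v : ι → A) (z : κ → B)
    [hv : Algebra.IsAlgebraic (Algebra.adjoin k (Set.range v)) A]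
    [hz : Algebra.IsAlgebraic (Algebra.adjoin k (Set.range z)) B]
    (hvz : AlgebraicIndependent k (Sum.elim (f ∘ v) (g ∘ z))) :
    Function.Injective (Algebra.TensorProduct.productMap f g) := by
  have := isDomain_tensorProduct k A B
  let μ := Algebra.TensorProduct.productMap f g
  let s : ι ⊕ κ → A ⊗[k] B := Sum.elim (fun i ↦ v i ⊗ₜ[k] (1 : B)) (fun i ↦ (1 : A) ⊗ₜ[k] z i)
  let c : MvPolynomial (ι ⊕ κ) k →ₐ[k] A ⊗[k] B := MvPolynomial.aeval s
  let _ : Algebra (MvPolynomial (ι ⊕ κ) k) (A ⊗[k] B) := c.toRingHom.toAlgebra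
  let _ : Algebra (MvPolynomial (ι ⊕ κ) k) K := (μ.comp c).toRingHom.toAlgebra
  let _ : Algebra (A ⊗[k] B) K := μ.toRingHom.toAlgebra
  have : IsScalarTower (MvPolynomial (ι ⊕ κ) k) (A ⊗[k] B) K := .of_algebraMap_eq fun _ ↦ rfl
  have hc : μ.comp c = MvPolynomial.aeval (Sum.elim (f ∘ v) (g ∘ z)) := by
    ext (i | i) <;> simp [c, s, μ]
  have hinj : Function.Injective (algebraMap (MvPolynomial (ι ⊕ κ) k) K) := by
    change Function.Injective (μ.comp c)
    rw [hc]
    exact hvz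
  have hvi : AlgebraicIndependent k v := .of_comp f (hvz.comp Sum.inl Sum.inl_injective)
  have hzi : AlgebraicIndependent k z := .of_comp g (hvz.comp Sum.inr Sum.inr_injective)
  have hleft (x : A) : IsAlgebraic (MvPolynomial (ι ⊕ κ) k) (x ⊗ₜ[k] (1 : B)) := by
    refine isAlgebraic_map_of_isAlgebraic_adjoin hvi (hv.isAlgebraic x)
      (Algebra.TensorProduct.includeLeft : A →ₐ[k] A ⊗[k] B) Sum.inl Sum.inl_injective fun p ↦ ?_
    change c.comp (MvPolynomial.rename Sum.inl) p =
      (Algebra.TensorProduct.includeLeft.comp (MvPolynomial.aeval v)) p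
    congr 1
    ext i
    simp [c, s]
  have hright (x : B) : IsAlgebraic (MvPolynomial (ι ⊕ κ) k) ((1 : A) ⊗ₜ[k] x) := by
    refine isAlgebraic_map_of_isAlgebraic_adjoin hzi (hz.isAlgebraic x)
      (Algebra.TensorProduct.includeRight : B →ₐ[k] A ⊗[k] B) Sum.inr Sum.inr_injective fun p ↦ ?_
    change c.comp (MvPolynomial.rename Sum.inr) p =
      (Algebra.TensorProduct.includeRight.comp (MvPolynomial.aeval z)) p
    congr 1
    ext i
    simp [c, s]
  have : Algebra.IsAlgebraic (MvPolynomial (ι ⊕ κ) k) (A ⊗[k] B) := by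
    refine ⟨fun u ↦ ?_⟩
    induction u with
    | zero => exact isAlgebraic_zero
    | tmul x y => simpa using (hleft x).mul (hright y)
    | add x y hx hy => exact hx.add hy
  exact Algebra.IsAlgebraic.injective_tower_top (A ⊗[k] B) hinj

/-- Given extensions `A` and `B` of an algebraically closed field `k` that embed into an
algebraically closed field `K` freely from each other, every automorphism of `A` extends to an
automorphism of `K` that is trivial on `B`. -/
theorem exists_ringEquiv_extending_of_algebraicIndependent {k K A B ι κ : Type*} [Field k]
    [IsAlgClosed k] [Field K] [IsAlgClosed K] [CommRing A] [IsDomain A] [CommRing B] [IsDomain B]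
    [Algebra k K] [Algebra k A] [Algebra k B] (f : A →ₐ[k] K) (g : B →ₐ[k] K)
    (v : ι → A) (z : κ → B)
    [Algebra.IsAlgebraic (Algebra.adjoin k (Set.range v)) A]
    [Algebra.IsAlgebraic (Algebra.adjoin k (Set.range z)) B]
    (hvz : AlgebraicIndependent k (Sum.elim (f ∘ v) (g ∘ z))) (σ : A ≃ₐ[k] A) :
    ∃ r : K ≃+* K, (∀ a, r (f a) = f (σ a)) ∧ ∀ b, r (g b) = g b := by
  have := isDomain_tensorProduct k A B
  let μ := Algebra.TensorProduct.productMap f g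
  let _ : Algebra (A ⊗[k] B) K := μ.toRingHom.toAlgebra
  have : FaithfulSMul (A ⊗[k] B) K := (faithfulSMul_iff_algebraMap_injective _ _).2
    (productMap_injective_of_algebraicIndependent f g v z hvz)
  obtain ⟨t, ht⟩ := exists_isTranscendenceBasis (A ⊗[k] B) K
  obtain ⟨r, hr, -⟩ := exists_ringEquiv_of_isTranscendenceBasis
    (Algebra.TensorProduct.congr σ (AlgEquiv.refl : B ≃ₐ[k] B)).toRingEquiv ht ht
  have hμ (u) : algebraMap (A ⊗[k] B) K u = μ u := rfl
  exact ⟨r, fun y ↦ by simpa [hμ, μ] using hr (y ⊗ₜ 1), fun y ↦ by simpa [hμ, μ] using hr (1 ⊗ₜ y)⟩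

section Closure

variable {K : Type*} [Field K]

theorem subset_cl (S : Set K) : S ⊆ cl K S := fun x hx ↦
  isAlgebraic_algebraMap (⟨x, Subfield.subset_closure hx⟩ : Subfield.closure S)

theorem map_mem_cl (σ : K ≃+* K) {S : Set K} {x : K} (hx : x ∈ cl K S) :
    σ x ∈ cl K (σ '' S) := by
  have h : Subfield.closure (σ '' S) = (Subfield.closure S).map (σ : K →+* K) :=
    (RingHom.map_field_closure (σ : K →+* K) S).symm
  let e : Subfield.closure S →+* Subfield.closure (σ '' S) :=
    ((σ : K →+* K).comp (Subfield.closure S).subtype).codRestrict _ fun y ↦ by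
      rw [h]
      exact ⟨y, y.2, rfl⟩
  have hx' : IsAlgebraic (Subfield.closure S) x := hx
  exact hx'.ringHom_of_comp_eq e (σ : K →+* K) e.injective rfl

theorem map_mem_cl_iff (σ : K ≃+* K) {S : Set K} {x : K} :
    σ x ∈ cl K (σ '' S) ↔ x ∈ cl K S := by
  refine ⟨fun h ↦ ?_, map_mem_cl σ⟩
  simpa [Set.image_image] using map_mem_cl σ.symm h

theorem mem_cl_union_iff (X : Subfield K) (S : Set K) (x : K) :
    x ∈ cl K (X ∪ S) ↔ IsAlgebraic (Algebra.adjoin X S) x := by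
  rw [← IntermediateField.isAlgebraic_adjoin_iff]
  have h : (IntermediateField.adjoin X S).toSubfield = Subfield.closure (X ∪ S) := by
    rw [IntermediateField.adjoin_toSubfield]
    congr
    exact Subtype.range_coe
  unfold cl
  rw [← h]
  rfl

/-- The relative algebraic closure of `X ∪ S`, as an extension of the subfield `X`. -/
def clField (X : Subfield K) (S : Set K) : IntermediateField X K :=
  (algebraicClosure (IntermediateField.adjoin X S) K).restrictScalars X

theorem mem_clField_iff {X : Subfield K} {S : Set K} {x : K} :
    x ∈ clField X S ↔ x ∈ cl K (X ∪ S) := by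
  rw [mem_cl_union_iff, ← IntermediateField.isAlgebraic_adjoin_iff, clField,
    IntermediateField.mem_restrictScalars, mem_algebraicClosure_iff]

/-- An automorphism of `K` restricting to an automorphism of `X` and mapping a family `c` to `c'`
maps the relative algebraic closure of `X` and `c` onto that of `X` and `c'`. -/
theorem map_mem_clField_iff {X : Subfield K} {ι : Type*} {c c' : ι → K} (F : K ≃+* K)
    (φ : X ≃+* X) (hφ : ∀ x : X, F x = φ x) (hc : ∀ i, F (c i) = c' i) {x : K} :
    F x ∈ clField X (Set.range c') ↔ x ∈ clField X (Set.range c) := by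
  rw [mem_clField_iff, mem_clField_iff, ← map_mem_cl_iff F (x := x), Set.image_union,
    ← Set.range_comp, show F ∘ c = c' from funext hc]
  have hX : F '' X = X := by
    ext y
    refine ⟨?_, fun hy ↦ ⟨φ.symm ⟨y, hy⟩, (φ.symm ⟨y, hy⟩).2, by simp [hφ]⟩⟩
    rintro ⟨x, hx, rfl⟩
    rw [hφ ⟨x, hx⟩]
    exact (φ _).2
  rw [hX]

theorem isAlgebraic_clField_range (X : Subfield K) {ι : Type*} (v : ι → K)
    (w : ι → clField X (Set.range v)) (hw : ∀ i, (w i : K) = v i) :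
    Algebra.IsAlgebraic (Algebra.adjoin X (Set.range w)) (clField X (Set.range v)) := by
  refine ⟨fun x ↦ ?_⟩
  have hx := (mem_cl_union_iff _ _ _).1 (mem_clField_iff.1 x.2)
  have h : Algebra.adjoin X (Set.range v) =
      (Algebra.adjoin X (Set.range w)).map (clField X (Set.range v)).val := by
    rw [AlgHom.map_adjoin, ← Set.range_comp]
    congr
    exact funext fun i ↦ (hw i).symm
  rw [h] at hx
  let e := (Algebra.adjoin X (Set.range w)).equivMapOfInjective (clField X (Set.range v)).val
    Subtype.val_injective
  exact hx.of_ringHom_of_comp_eq e (clField X (Set.range v)).val e.surjective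
    Subtype.val_injective rfl

theorem RelAlgClosed.isAlgClosed [IsAlgClosed K] {X : Subfield K} (hX : RelAlgClosed X) :
    IsAlgClosed X := by
  refine IsAlgClosed.of_exists_root X fun p hp hirr ↦ ?_
  obtain ⟨x, hx⟩ := IsAlgClosed.exists_aeval_eq_zero K p
    (Polynomial.degree_pos_of_irreducible hirr).ne'
  have hxX : x ∈ X := hX x ⟨p, hp.ne_zero, hx⟩
  refine ⟨⟨x, hxX⟩, Subtype.val_injective ?_⟩
  have := Polynomial.aeval_algebraMap_apply K (⟨x, hxX⟩ : X) p
  rw [Polynomial.coe_aeval_eq_eval] at this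
  exact this.symm.trans hx

theorem SmallTrdeg.cardinalMk_lt [Uncountable K] {X : Subfield K} [IsAlgClosed X]
    (hX : SmallTrdeg X) : #X < #K := by
  obtain ⟨s, hs, hsK⟩ := hX
  have hK : ℵ₀ < #K := aleph0_lt_mk
  have hbot : #(⊥ : Subfield X) ≤ ℵ₀ := by
    rw [← Subfield.closure_empty]
    simpa using Subfield.cardinalMk_closure_le_max (∅ : Set X)
  exact (IsAlgClosed.cardinal_le_max_transcendence_basis' _ hs).trans_lt
    (max_lt (max_lt (hbot.trans_lt hK) hsK) hK)

theorem IsTranscendenceBasis.cardinalMk_eq_of_subfield [IsAlgClosed K] [Uncountable K]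
    {X : Subfield K} (hX : #X < #K) {T : Set K}
    (hT : IsTranscendenceBasis X ((↑) : T → K)) : #T = #K := by
  refine (mk_set_le T).antisymm (le_of_not_gt fun h ↦ ?_)
  exact ((IsAlgClosed.cardinal_le_max_transcendence_basis' _ hT).trans_lt
    (max_lt (max_lt hX h) aleph0_lt_mk)).false

end Closure

section Extension

universe u

variable {K : Type u} [Field K] [IsAlgClosed K] [Uncountable K] {X : Subfield K}

theorem exists_isTranscendenceBasis_cardinalMk_sdiff (hX : #X < #K) {ι : Type*} [Countable ι]
    {c : ι → K} (hc : AlgebraicIndependent X c) :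
    ∃ T : Set K, Set.range c ⊆ T ∧ #(T \ Set.range c : Set K) = #K ∧
      IsTranscendenceBasis X ((↑) : T → K) := by
  obtain ⟨T, hT, hTb⟩ := exists_isTranscendenceBasis_superset hc.coe_range
  refine ⟨T, hT, (mk_set_le _).antisymm (le_of_not_gt fun h ↦ ?_), hTb⟩
  have hR : #(Set.range c) < #K :=
    (mk_le_aleph0_iff.2 (Set.countable_range c).to_subtype).trans_lt aleph0_lt_mk
  have := le_mk_sdiff_add_mk T (Set.range c)
  rw [hTb.cardinalMk_eq_of_subfield hX] at this
  exact (this.trans_lt (add_lt_of_lt aleph0_lt_mk.le h hR)).false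

/-- Automorphisms of a small subfield extend to the whole field, with prescribed values on a
countable independent family. -/
theorem exists_ringEquiv_extending (hX : #X < #K) {ι : Type*} [Countable ι] {c c' : ι → K}
    (hc : AlgebraicIndependent X c) (hc' : AlgebraicIndependent X c') (φ : X ≃+* X) :
    ∃ F : K ≃+* K, (∀ x : X, F x = φ x) ∧ ∀ i, F (c i) = c' i := by
  classical
  obtain ⟨T, hcT, hT, hTb⟩ := exists_isTranscendenceBasis_cardinalMk_sdiff hX hc
  obtain ⟨T', hcT', hT', hTb'⟩ := exists_isTranscendenceBasis_cardinalMk_sdiff hX hc'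
  obtain ⟨e⟩ := Cardinal.eq.1 (hT.trans hT'.symm)
  let e₀ := (Equiv.ofInjective c hc.injective).symm.trans (Equiv.ofInjective c' hc'.injective)
  let E : T ≃ T' := ((Equiv.Set.sumDiffSubset hcT).symm.trans (e₀.sumCongr e)).trans
    (Equiv.Set.sumDiffSubset hcT')
  have hE (i) : (E ⟨c i, hcT ⟨i, rfl⟩⟩ : K) = c' i := by
    change (E (Equiv.Set.sumDiffSubset hcT (Sum.inl (Equiv.ofInjective c hc.injective i))) : K) = _
    simp only [E, Equiv.trans_apply, Equiv.symm_apply_apply, Equiv.sumCongr_apply, Sum.map_inl]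
    simp [e₀, -Equiv.ofInjective_apply]
    simp
  obtain ⟨F, hF, hFT⟩ := exists_ringEquiv_of_isTranscendenceBasis φ hTb
    ((isTranscendenceBasis_equiv E).2 hTb')
  exact ⟨F, hF, fun i ↦ (hFT ⟨c i, hcT ⟨i, rfl⟩⟩).trans (hE i)⟩

end Extension

theorem algebraicIndependent_insert {K : Type*} [Field K] {X : Subfield K} {S : Set K} {x : K}
    (hS : AlgebraicIndependent X ((↑) : S → K)) (hx : x ∉ cl K (X ∪ S)) :
    AlgebraicIndependent X ((↑) : ↥(insert x S) → K) := by
  rw [mem_cl_union_iff] at hx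
  have hS' : AlgebraicIndepOn X id S := hS
  have hx' : Transcendental (Algebra.adjoin X (id '' S)) (id x) := by rwa [Set.image_id]
  exact hS'.insert hx'

theorem exists_algebraicIndependent_of_not_isBounded {K : Type*} [Field K] [Uncountable K]
    {τ : K ≃+* K} (hτ : ¬ IsBounded τ) {X : Subfield K} (hX : #X < #K) :
    ∃ d : ℕ → K, AlgebraicIndependent X (Sum.elim d (τ ∘ d)) := by
  have hstep (S : Set K) : ∃ b, S.Finite →
      b ∉ cl K (X ∪ S) ∧ τ b ∉ cl K (X ∪ insert b S) := by
    by_cases hS : S.Finite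
    · have hcard : #(X ∪ S : Set K) < #K := (mk_union_le _ _).trans_lt
        (add_lt_of_lt aleph0_lt_mk.le hX (hS.lt_aleph0.trans aleph0_lt_mk))
      by_contra! h
      refine hτ ⟨X ∪ S, hcard, fun b hb ↦ ?_⟩
      rw [Set.union_assoc, Set.union_singleton]
      exact (h b).2 hb
    · exact ⟨0, fun h ↦ (hS h).elim⟩
  choose F hF using hstep
  obtain ⟨S, hS₀, hS⟩ : ∃ S : ℕ → Set K, S 0 = ∅ ∧
      ∀ n, S (n + 1) = insert (τ (F (S n))) (insert (F (S n)) (S n)) :=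
    ⟨Nat.rec ∅ fun _ S ↦ insert (τ (F S)) (insert (F S) S), rfl, fun _ ↦ rfl⟩
  have hfin (n) : (S n).Finite := by
    induction n with
    | zero => exact hS₀ ▸ Set.finite_empty
    | succ n ih => exact hS n ▸ (ih.insert _).insert _
  have hmono : Monotone S := monotone_nat_of_le_succ fun n ↦ hS n ▸
    (Set.subset_insert _ _).trans (Set.subset_insert _ _)
  have hd (n) : F (S n) ∈ S (n + 1) := by simp [hS]
  have hτd (n) : τ (F (S n)) ∈ S (n + 1) := by simp [hS]
  have hd' (n) : F (S n) ∉ S n := fun h ↦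
    (hF _ (hfin n)).1 (subset_cl _ (Or.inr h))
  have hτd' (n) : τ (F (S n)) ∉ insert (F (S n)) (S n) := fun h ↦
    (hF _ (hfin n)).2 (subset_cl _ (Or.inr h))
  have hind : AlgebraicIndependent X ((↑) : (⋃ n, S n) → K) := by
    refine algebraicIndependent_iUnion_of_directed hmono.directed_le fun n ↦ ?_
    induction n with
    | zero =>
      rw [hS₀]
      exact algebraicIndependent_empty
    | succ n ih =>
      rw [hS]
      exact algebraicIndependent_insert (algebraicIndependent_insert ih (hF _ (hfin n)).1)
        (hF _ (hfin n)).2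
  have hinj : Function.Injective fun n ↦ F (S n) := by
    refine Function.Injective.of_lt_imp_ne fun m n hmn h ↦ hd' n ?_
    exact h ▸ hmono hmn (hd m)
  refine ⟨fun n ↦ F (S n), ?_⟩
  let e : ℕ ⊕ ℕ → ⋃ n, S n := Sum.elim
    (fun n ↦ ⟨F (S n), Set.mem_iUnion.2 ⟨n + 1, hd n⟩⟩)
    (fun n ↦ ⟨τ (F (S n)), Set.mem_iUnion.2 ⟨n + 1, hτd n⟩⟩)
  have he : Sum.elim (fun n ↦ F (S n)) (τ ∘ fun n ↦ F (S n)) = (↑) ∘ e := by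
    ext (n | n) <;> rfl
  rw [he]
  refine hind.comp e (Function.Injective.of_comp (f := ((↑) : _ → K)) ?_)
  rw [← he]
  refine hinj.sumElim (τ.injective.comp hinj) fun m n h ↦ ?_
  change F (S m) = τ (F (S n)) at h
  rcases lt_trichotomy m n with hmn | rfl | hmn
  · exact hτd' n (Or.inr (h ▸ hmono hmn (hd m)))
  · exact hτd' m (Or.inl h.symm)
  · exact hd' m (h ▸ hmono hmn (hτd n))

theorem exists_ringEquiv_coe_eq {K : Type*} [Field K] {X : Subfield K} (F : K ≃+* K)
    (V : IntermediateField X K) (Y : Subfield K) (hF : ∀ x, F x ∈ Y ↔ x ∈ V) :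
    ∃ e : V ≃+* Y, ∀ x : V, (e x : K) = F x := by
  let e : V →+* Y := ((F : K →+* K).comp V.val.toRingHom).codRestrict Y fun x ↦ (hF x).2 x.2
  refine ⟨RingEquiv.ofBijective e ⟨e.injective, fun y ↦ ?_⟩, fun x ↦ rfl⟩
  refine ⟨⟨F.symm y, (hF _).1 (by simp)⟩, Subtype.val_injective ?_⟩
  exact F.apply_symm_apply y

/-- The central proposition: given automorphisms `f`, `g` of a `τ`-invariant small
relatively algebraically closed subfield `X`, an acceptable extension `Y` of `X` and an
automorphism `h` of `Y` extending `Ψ_X(f,g)`, there are automorphisms `f'`, `g'` of `K`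
extending `f` and `g` with `Ψ(f',g')` extending `h`. -/
theorem central_proposition (K : Type*) [Field K] [IsAlgClosed K] [Uncountable K]
    (htr : FullTrdeg K)
    (τ : K ≃+* K) (hτu : ¬ IsBounded τ)
    (hτfix : ∀ a : K, IsAlgebraic (⊥ : Subfield K) a → τ a = a)
    (X : Subfield K) (hX1 : RelAlgClosed X) (hX2 : ContainsBotAlg X) (hX3 : SmallTrdeg X)
    (hXτ : X.map (τ : K →+* K) = X)
    (f g : ↥X ≃+* ↥X)
    (Y : Subfield K) (hY : Acceptable X Y)
    (h : ↥Y ≃+* ↥Y)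
    (hh : ∀ x (hx : x ∈ X),
      (h ⟨x, hY.1 hx⟩ : K) = (psi (restrict τ X hXτ) f g ⟨x, hx⟩ : K)) :
    ∃ f' g' : K ≃+* K,
      (∀ x (hx : x ∈ X), f' x = (f ⟨x, hx⟩ : K)) ∧
      (∀ x (hx : x ∈ X), g' x = (g ⟨x, hx⟩ : K)) ∧
      (∀ y (hy : y ∈ Y), psi τ f' g' y = (h ⟨y, hy⟩ : K)) := by
  have hXc : IsAlgClosed X := hX1.isAlgClosed
  have hXK : #X < #K := hX3.cardinalMk_lt
  obtain ⟨d, hd⟩ := exists_algebraicIndependent_of_not_isBounded hτu hXK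
  obtain ⟨hXY, A, hAc, hAi, hA, hYA⟩ := hY
  have := hAc.to_subtype
  have := hAi.to_subtype
  obtain ⟨eA⟩ := nonempty_equiv_of_countable (α := ℕ) (β := A)
  let a : ℕ → K := (↑) ∘ eA
  have ha : AlgebraicIndependent X a := hA.comp eA eA.injective
  have hY' (y : K) : y ∈ Y ↔ y ∈ clField X (Set.range a) := by
    rw [mem_clField_iff, ← SetLike.mem_coe, hYA, eA.surjective.range_comp, Subtype.range_coe]
  let b : ℕ → K := τ ∘ d
  have hb : AlgebraicIndependent X b := hd.comp Sum.inr Sum.inr_injective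
  obtain ⟨f', hf', hf'b⟩ := exists_ringEquiv_extending hXK hb ha f
  obtain ⟨G, hG, hGdb⟩ := exists_ringEquiv_extending hXK hd hd g
  let V := clField X (Set.range d)
  let Z := clField X (Set.range b)
  have hτV (x : K) : τ x ∈ Z ↔ x ∈ V :=
    map_mem_clField_iff τ (restrict τ X hXτ) (fun _ ↦ rfl) fun _ ↦ rfl
  have hGV (x : K) : G x ∈ V ↔ x ∈ V := map_mem_clField_iff G g hG fun i ↦ hGdb (Sum.inl i)
  have hGZ (x : K) : G x ∈ Z ↔ x ∈ Z := map_mem_clField_iff G g hG fun i ↦ hGdb (Sum.inr i)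
  have hfZ (x : K) : f' x ∈ Y ↔ x ∈ Z := (hY' _).trans (map_mem_clField_iff f' f hf' hf'b)
  obtain ⟨Φ, hΦ⟩ := exists_ringEquiv_coe_eq ((τ.trans G).trans f') V Y fun x ↦
    (hfZ _).trans ((hGZ _).trans (hτV x))
  obtain ⟨Ψ, hΨ⟩ := exists_ringEquiv_coe_eq ((G.trans τ).trans f') V Y fun x ↦
    (hfZ _).trans ((hτV _).trans (hGV x))
  simp only [RingEquiv.coe_trans, Function.comp_apply] at hΦ hΨ
  let t := restrict τ X hXτ
  have ht (x : X) : τ x = t x := rfl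
  have hcoe (x : X) : (algebraMap X V x : K) = x := rfl
  have hfix (x : X) : h (Φ (algebraMap X V x)) = Ψ (algebraMap X V x) := by
    have h₁ : Φ (algebraMap X V x) = ⟨f (g (t x)), hXY (f (g (t x))).2⟩ :=
      Subtype.val_injective <| (hΦ _).trans <| by
        rw [hcoe, ht, hG, hf']
    refine Subtype.val_injective ?_
    rw [h₁, hh _ (f (g (t x))).2, hΨ, hcoe, hG, ht, hf']
    simp [psi, t]
  let σ : V ≃ₐ[X] V := AlgEquiv.ofRingEquiv (f := (Φ.trans h).trans Ψ.symm) fun x ↦ by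
    simp [hfix]
  have hσ (x : V) : Ψ (σ x) = h (Φ x) := Ψ.apply_symm_apply _
  have hdV (i) : d i ∈ V := mem_clField_iff.2 (subset_cl _ (Or.inr ⟨i, rfl⟩))
  have hbZ (i) : b i ∈ Z := mem_clField_iff.2 (subset_cl _ (Or.inr ⟨i, rfl⟩))
  have hVa := isAlgebraic_clField_range X d (fun i ↦ ⟨d i, hdV i⟩) fun _ ↦ rfl
  have hZa := isAlgebraic_clField_range X b (fun i ↦ ⟨b i, hbZ i⟩) fun _ ↦ rfl
  obtain ⟨r, hrV, hrZ⟩ := exists_ringEquiv_extending_of_algebraicIndependent V.val Z.val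
    (fun i ↦ ⟨d i, hdV i⟩) (fun i ↦ ⟨b i, hbZ i⟩) hd σ
  have hr (x : K) (hx : x ∈ Z) : r x = x := hrZ ⟨x, hx⟩
  refine ⟨f', r.trans G, fun x hx ↦ hf' ⟨x, hx⟩, fun x hx ↦ ?_, fun y hy ↦ ?_⟩
  · rw [RingEquiv.trans_apply, hr x (Z.algebraMap_mem ⟨x, hx⟩)]
    exact hG ⟨x, hx⟩
  · obtain ⟨u, hu⟩ := Φ.surjective ⟨y, hy⟩
    have hy' : f' (G (τ u)) = y := by rw [← hΦ, hu]
    have hru : r.symm (τ u) = τ u := by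
      rw [RingEquiv.symm_apply_eq, hr _ ((hτV u).2 u.2)]
    calc psi τ f' (r.trans G) y = f' (τ (G (r u))) := by
          rw [← hy']
          simp [psi, hru]
      _ = Ψ (σ u) := by rw [hΨ]; exact congrArg (fun x ↦ f' (τ (G x))) (hrV u)
      _ = h ⟨y, hy⟩ := by rw [hσ, hu]
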